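/- Let G be a digraph with transitive closure Ḡ, let f̄ be a discrete Morse function on Ḡ, with V̄ = grad f̄ and Φ̄ = Id + ∂V̄ + V̄∂ on Ḡ. Suppose Ω_*(G) is V̄-invariant (V̄(Ω_n(G)) ⊆ Ω_{n+1}(G) for all n) and Φ̄(α) ∈ Ω(G) for every allowed elementary path α on G that is critical in Ḡ. Set l_m = dim(Crit_m(Ḡ) ∩ P_m(G)) and b_m = dim H_m(G;ℝ). Then the strong Morse inequalities hold: for every m ≥ 0, l_m − l_{m−1} + ⋯ + (−1)^m l_0 ≥ b_m − b_{m−1} + ⋯ + (−1)^m b_0; moreover the Euler characteristics agree, Σ_{p≥0} (−1)^p l_p = Σ_{p≥0} (−1)^p b_p. -/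

import Mathlib

open scoped BigOperators Classical

namespace PathMorse

/-- A digraph: an irreflexive edge relation on a vertex set. -/
structure Digraph (V : Type) where
  E : V → V → Prop
  irrefl : ∀ v, ¬ E v v

/-- A digraph is transitive if `u→v` and `v→w` imply `u→w`. -/
def Digraph.Transitive {V : Type} (G : Digraph V) : Prop :=
  ∀ u v w, G.E u v → G.E v w → G.E u w

/-- `Gbar` is the transitive closure of `G`: the smallest transitive digraph containing `G`. -/
def IsTransClosure {V : Type} (G Gbar : Digraph V) : Prop :=
  Gbar.Transitive ∧ (∀ u v, G.E u v → Gbar.E u v) ∧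
    ∀ H : Digraph V, H.Transitive → (∀ u v, G.E u v → H.E u v) →
      ∀ u v, Gbar.E u v → H.E u v

/-- An elementary `n`-path on `V`: a sequence of `n+1` vertices. -/
abbrev Path (V : Type) (n : ℕ) := Fin (n+1) → V

/-- An elementary path is allowed on `G` if consecutive vertices are joined by directed edges. -/
def Allowed {V : Type} (G : Digraph V) {n : ℕ} (p : Path V n) : Prop :=
  ∀ i : Fin n, G.E (p i.castSucc) (p i.succ)

/-- The `i`-th face of a path: delete the `i`-th vertex. -/
def face {V : Type} {n : ℕ} (i : Fin (n+2)) (p : Path V (n+1)) : Path V n :=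
  p ∘ i.succAbove

/-- `q` is obtained from `p` by deleting one vertex (the codimension-one relation `q < p`). -/
def IsFace {V : Type} {n : ℕ} (q : Path V n) (p : Path V (n+1)) : Prop :=
  ∃ i : Fin (n+2), face i p = q

/-- Value of `f` on a path: sum of the values at the vertices. -/
def fPath {V : Type} (f : V → ℝ) {n : ℕ} (p : Path V n) : ℝ :=
  ∑ i, f (p i)

/-- There is an allowed coface `γ > p` with `f γ = f p`. -/
def HasEqualCoface {V : Type} (G : Digraph V) (f : V → ℝ) {n : ℕ} (p : Path V n) : Prop :=
  ∃ γ : Path V (n+1), Allowed G γ ∧ IsFace p γ ∧ fPath f γ = fPath f p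

/-- There is an allowed face `β < p` with `f β = f p`. -/
def HasEqualFace {V : Type} (G : Digraph V) (f : V → ℝ) : (n : ℕ) → Path V n → Prop
  | 0, _ => False
  | (n+1), p => ∃ β : Path V n, Allowed G β ∧ IsFace β p ∧ fPath f β = fPath f p

/-- A discrete Morse function on a digraph: nonnegative, and for each allowed elementary path
there is at most one allowed coface with the same value, and at most one allowed face with the
same value. -/
def IsMorse {V : Type} (G : Digraph V) (f : V → ℝ) : Prop :=
  (∀ v, 0 ≤ f v) ∧
  (∀ n (α : Path V n), Allowed G α →
    ∀ γ₁ γ₂ : Path V (n+1), Allowed G γ₁ → Allowed G γ₂ → IsFace α γ₁ → IsFace α γ₂ →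
      fPath f γ₁ = fPath f α → fPath f γ₂ = fPath f α → γ₁ = γ₂) ∧
  (∀ n (α : Path V (n+1)), Allowed G α →
    ∀ β₁ β₂ : Path V n, Allowed G β₁ → Allowed G β₂ → IsFace β₁ α → IsFace β₂ α →
      fPath f β₁ = fPath f α → fPath f β₂ = fPath f α → β₁ = β₂)

/-- A critical path: allowed, with no allowed coface of equal value, no allowed face of equal value. -/
def IsCritical {V : Type} (G : Digraph V) (f : V → ℝ) {n : ℕ} (p : Path V n) : Prop :=
  Allowed G p ∧ ¬ HasEqualCoface G f p ∧ ¬ HasEqualFace G f n p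

/-- `n`-chains: the real vector space with (orthonormal) basis the elementary `n`-paths. -/
abbrev Chain (V : Type) (n : ℕ) := Path V n → ℝ

variable {V : Type} [Fintype V] [DecidableEq V]

/-- The basis chain corresponding to an elementary path. -/
def unitP {n : ℕ} (p : Path V n) : Chain V n := Pi.single p 1

/-- The boundary operator on chains (as a bare function). -/
def boundaryFun {n : ℕ} (x : Chain V (n+1)) : Chain V n :=
  fun q => ∑ p : Path V (n+1), x p * ∑ i : Fin (n+2), ((-1:ℝ)^(i:ℕ)) * (if face i p = q then 1 else 0)

/-- The boundary operator `∂ = Σ (-1)^i d_i` as a linear map. -/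
def boundary (V : Type) [Fintype V] [DecidableEq V] (n : ℕ) : Chain V (n+1) →ₗ[ℝ] Chain V n where
  toFun := boundaryFun
  map_add' x y := by
    funext q
    simp [boundaryFun, add_mul, Finset.sum_add_distrib]
  map_smul' c x := by
    funext q
    simp [boundaryFun, Finset.mul_sum, mul_assoc]

/-- `P_n(G)`: the span of the allowed elementary `n`-paths. -/
def pSpan (G : Digraph V) (n : ℕ) : Submodule ℝ (Chain V n) :=
  Submodule.span ℝ {x : Chain V n | ∃ p : Path V n, Allowed G p ∧ x = unitP p}

/-- `Ω_n(G) = {x ∈ P_n(G) : ∂x ∈ P_{n-1}(G)}` (with `Ω_0 = P_0`). -/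
def omega (G : Digraph V) : (n : ℕ) → Submodule ℝ (Chain V n)
  | 0 => pSpan G 0
  | (n+1) => pSpan G (n+1) ⊓ (pSpan G n).comap (boundary V n)

/-- The discrete gradient vector field on a basis path: `V(α) = -⟨∂γ,α⟩ γ` if there is an
allowed coface `γ > α` with `f γ = f α`, and `0` otherwise. -/
noncomputable def gradFun (G : Digraph V) (f : V → ℝ) {n : ℕ} (α : Path V n) : Chain V (n+1) :=
  if h : Allowed G α ∧ ∃ γ : Path V (n+1), Allowed G γ ∧ IsFace α γ ∧ fPath f γ = fPath f α then
    (-(boundary V n (unitP h.2.choose) α)) • unitP h.2.choose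
  else 0

/-- The discrete gradient vector field `V = grad f`, extended linearly to chains. -/
noncomputable def grad (G : Digraph V) (f : V → ℝ) (n : ℕ) : Chain V n →ₗ[ℝ] Chain V (n+1) where
  toFun x := ∑ α : Path V n, x α • gradFun G f α
  map_add' x y := by simp [add_smul, Finset.sum_add_distrib]
  map_smul' c x := by simp [Finset.smul_sum, smul_smul]

/-- The composite `V∂` in degree `n` (zero in degree `0`). -/
noncomputable def vd (G : Digraph V) (f : V → ℝ) : (n : ℕ) → (Chain V n →ₗ[ℝ] Chain V n)
  | 0 => 0
  | (n+1) => (grad G f n).comp (boundary V n)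

/-- The discrete gradient flow `Φ = Id + ∂V + V∂`. -/
noncomputable def flow (G : Digraph V) (f : V → ℝ) (n : ℕ) : Chain V n →ₗ[ℝ] Chain V n :=
  LinearMap.id + (boundary V n).comp (grad G f n) + vd G f n

/-- `P_n^Φ(G) = {x ∈ P_n(G) : Φ x = x}`. -/
noncomputable def pPhi (G : Digraph V) (f : V → ℝ) (n : ℕ) : Submodule ℝ (Chain V n) :=
  pSpan G n ⊓ LinearMap.ker (flow G f n - LinearMap.id)

/-- The cycles of a chain complex of subspaces `C` with differentials `D`
(in degree `0`, everything is a cycle). -/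
def cycles (C : ∀ n, Submodule ℝ (Chain V n)) (D : ∀ n, Chain V (n+1) →ₗ[ℝ] Chain V n) :
    (m : ℕ) → Submodule ℝ (Chain V m)
  | 0 => C 0
  | (m+1) => C (m+1) ⊓ LinearMap.ker (D m)

/-- Homology of the chain complex `(C, D)`: cycles modulo boundaries coming from `C`. -/
abbrev Homology (C : ∀ n, Submodule ℝ (Chain V n)) (D : ∀ n, Chain V (n+1) →ₗ[ℝ] Chain V n)
    (m : ℕ) :=
  (cycles C D m) ⧸ (Submodule.comap (cycles C D m).subtype ((C (m+1)).map (D m)))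

/-- The operator `e^{tf}` on chains. -/
noncomputable def expOp (f : V → ℝ) (t : ℝ) (n : ℕ) : Chain V n →ₗ[ℝ] Chain V n where
  toFun x := fun p => Real.exp (t * fPath f p) * x p
  map_add' x y := by funext p; simp [mul_add]
  map_smul' c x := by funext p; simp; ring

/-- The deformed boundary `∂_t = e^{tf} ∂ e^{-tf}`. -/
noncomputable def dT (f : V → ℝ) (t : ℝ) (n : ℕ) : Chain V (n+1) →ₗ[ℝ] Chain V n :=
  (expOp f t n).comp ((boundary V n).comp (expOp f (-t) (n+1)))

/-- The span of the elementary `n`-paths that are critical in `Gbar` and allowed in `G`. -/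
def critSpan (G Gbar : Digraph V) (f : V → ℝ) (n : ℕ) : Submodule ℝ (Chain V n) :=
  Submodule.span ℝ {x : Chain V n | ∃ α : Path V n, IsCritical Gbar f α ∧ Allowed G α ∧ x = unitP α}

theorem boundary_unitP {n : ℕ} (p : Path V (n+1)) :
    boundary V n (unitP p) = ∑ i : Fin (n+2), ((-1:ℝ)^(i:ℕ)) • unitP (face i p) := by
  funext q
  change boundaryFun (unitP p) q = _
  rw [boundaryFun, Finset.sum_eq_single p]
  · simp only [unitP, Pi.single_eq_same, one_mul, Finset.sum_apply, Pi.smul_apply, smul_eq_mul,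
      Pi.single_apply, eq_comm]
  · intro b _ hb
    simp [unitP, Pi.single_eq_of_ne hb]
  · simp

theorem linearMap_ext_unitP {n : ℕ} {M : Type*} [AddCommGroup M] [Module ℝ M]
    {A B : Chain V n →ₗ[ℝ] M} (h : ∀ p, A (unitP p) = B (unitP p)) : A = B :=
  LinearMap.pi_ext' fun p => LinearMap.ext_ring (h p)

theorem sum_smul_unitP {n : ℕ} (x : Chain V n) : ∑ p, x p • unitP p = x := by
  funext q
  simp [unitP, Finset.sum_apply, Pi.single_apply]

theorem face_face_swap {V : Type} {n : ℕ} (p : Path V (n+2)) (i : Fin (n+3)) (j : Fin (n+2)) :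
    face (j.predAbove i) (face (i.succAbove j) p) = face j (face i p) := by
  funext k
  simp [face, Fin.succAbove_succAbove_succAbove_predAbove]

theorem boundary_boundary (n : ℕ) (x : Chain V (n+2)) :
    boundary V n (boundary V (n+1) x) = 0 := by
  suffices h : (boundary V n).comp (boundary V (n+1)) = 0 from LinearMap.congr_fun h x
  refine linearMap_ext_unitP fun p => ?_
  simp only [LinearMap.comp_apply, boundary_unitP, map_sum, map_smul, LinearMap.zero_apply,
    Finset.smul_sum, smul_smul, ← pow_add]
  rw [← Finset.sum_product']
  refine Finset.sum_involution (fun a _ => (a.1.succAbove a.2, a.2.predAbove a.1)) ?_ ?_ ?_ ?_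
  · rintro ⟨i, j⟩ -
    simp only
    rw [face_face_swap, Fin.neg_one_pow_succAbove_add_predAbove, neg_smul, add_neg_cancel]
  · rintro ⟨i, j⟩ - - h
    exact Fin.succAbove_ne i j (congrArg Prod.fst h)
  · simp
  · rintro ⟨i, j⟩ -
    simp [Fin.succAbove_succAbove_predAbove, Fin.predAbove_predAbove_succAbove]

theorem eq_zero_of_mem_pSpan {V : Type} [DecidableEq V] {G : Digraph V} {n : ℕ} {x : Chain V n} (hx : x ∈ pSpan G n)
    {p : Path V n} (hp : ¬ Allowed G p) : x p = 0 := by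
  have h : pSpan G n ≤ LinearMap.ker (LinearMap.proj (R := ℝ) (φ := fun _ : Path V n => ℝ) p) := by
    refine Submodule.span_le.2 ?_
    rintro _ ⟨q, hq, rfl⟩
    have hne : p ≠ q := fun h => hp (h ▸ hq)
    simp [unitP, hne]
  simpa using h hx

theorem omega_le_pSpan (G : Digraph V) (n : ℕ) : omega G n ≤ pSpan G n := by
  cases n with
  | zero => exact le_rfl
  | succ n => exact inf_le_left

theorem boundary_mem_omega {G : Digraph V} {n : ℕ} {x : Chain V (n+1)} (hx : x ∈ omega G (n+1)) :
    boundary V n x ∈ omega G n := by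
  cases n with
  | zero => exact hx.2
  | succ n =>
    refine ⟨hx.2, ?_⟩
    rw [SetLike.mem_coe, Submodule.mem_comap, boundary_boundary]
    exact zero_mem _

theorem Allowed.edge_of_lt {V : Type} {G : Digraph V} (hG : G.Transitive) {n : ℕ} {p : Path V n}
    (hp : Allowed G p) {i j : Fin (n+1)} (hij : i < j) : G.E (p i) (p j) := by
  have : IsTrans V G.E := ⟨hG⟩
  exact (Fin.liftFun_iff_succ G.E).2 hp hij

theorem Allowed.injective {V : Type} {G : Digraph V} (hG : G.Transitive) {n : ℕ} {p : Path V n}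
    (hp : Allowed G p) : Function.Injective p := by
  intro i j h
  rcases lt_trichotomy i j with hij | hij | hij
  · exact absurd (h ▸ hp.edge_of_lt hG hij) (G.irrefl _)
  · exact hij
  · exact absurd (h ▸ hp.edge_of_lt hG hij) (G.irrefl _)

theorem Allowed.face {V : Type} {G : Digraph V} (hG : G.Transitive) {n : ℕ} {p : Path V (n+1)}
    (hp : Allowed G p) (i : Fin (n+2)) : Allowed G (face i p) := fun k =>
  hp.edge_of_lt hG (Fin.strictMono_succAbove i k.castSucc_lt_succ)

theorem fPath_face {V : Type} (f : V → ℝ) {n : ℕ} (p : Path V (n+1)) (i : Fin (n+2)) :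
    fPath f p = f (p i) + fPath f (face i p) :=
  Fin.sum_univ_succAbove _ i

theorem face_injective {V : Type} {n : ℕ} {p : Path V (n+1)} (hp : Function.Injective p) :
    Function.Injective fun i => face i p := by
  intro i j h
  by_contra hne
  obtain ⟨k, hk⟩ := Fin.exists_succAbove_eq hne
  have h1 : p (i.succAbove k) = p i := by
    have := congrFun h k
    simpa only [PathMorse.face, Function.comp_apply, hk] using this
  exact Fin.succAbove_ne i k (hp h1)

theorem eq_of_apply_eq_zero {V : Type} {G : Digraph V} {f : V → ℝ} (hG : G.Transitive)
    (hf : IsMorse G f) {n : ℕ} {p : Path V n} (hp : Allowed G p) {i j : Fin (n+1)}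
    (hi : f (p i) = 0) (hj : f (p j) = 0) : i = j := by
  cases n with
  | zero => exact Subsingleton.elim (α := Fin 1) _ _
  | succ n =>
    refine face_injective (hp.injective hG) (hf.2.2 n p hp _ _ (hp.face hG i) (hp.face hG j)
      ⟨i, rfl⟩ ⟨j, rfl⟩ ?_ ?_)
    · rw [fPath_face f p i, hi, zero_add]
    · rw [fPath_face f p j, hj, zero_add]

theorem not_hasEqualCoface_of_apply_eq_zero {V : Type} {G : Digraph V} {f : V → ℝ}
    (hG : G.Transitive) (hf : IsMorse G f) {n : ℕ} {p : Path V n} {i : Fin (n+1)}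
    (hi : f (p i) = 0) : ¬ HasEqualCoface G f p := by
  rintro ⟨γ, hγ, ⟨j, rfl⟩, hval⟩
  have hj : f (γ j) = 0 := by rwa [fPath_face f γ j, add_eq_right] at hval
  exact Fin.succAbove_ne j i (eq_of_apply_eq_zero hG hf hγ hi hj)

theorem grad_unitP (G : Digraph V) (f : V → ℝ) {n : ℕ} (p : Path V n) :
    grad G f n (unitP p) = gradFun G f p := by
  change ∑ α : Path V n, unitP p α • gradFun G f α = _
  rw [Finset.sum_eq_single p]
  · simp [unitP]
  · intro b _ hb
    simp [unitP, hb]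
  · simp

theorem grad_unitP_eq_zero {G : Digraph V} {f : V → ℝ} {n : ℕ} {p : Path V n}
    (hp : ¬ HasEqualCoface G f p) : grad G f n (unitP p) = 0 := by
  rw [grad_unitP, gradFun, dif_neg fun h => hp h.2]

theorem boundary_unitP_apply_face {n : ℕ} {p : Path V (n+1)} (hp : Function.Injective p)
    (i : Fin (n+2)) : boundary V n (unitP p) (face i p) = (-1) ^ (i : ℕ) := by
  rw [boundary_unitP, Finset.sum_apply, Finset.sum_eq_single i]
  · simp [unitP]
  · intro j _ hj
    have hne : face i p ≠ face j p := fun h => hj (face_injective hp h).symm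
    simp [unitP, hne]
  · simp

theorem grad_unitP_face {G : Digraph V} {f : V → ℝ} (hG : G.Transitive) (hf : IsMorse G f)
    {n : ℕ} {γ : Path V (n+1)} (hγ : Allowed G γ) {i : Fin (n+2)} (hi : f (γ i) = 0) :
    grad G f n (unitP (face i γ)) = (-(-1 : ℝ) ^ (i : ℕ)) • unitP γ := by
  have hval : fPath f γ = fPath f (face i γ) := by rw [fPath_face f γ i, hi, zero_add]
  have hα := hγ.face hG i
  have h : Allowed G (face i γ) ∧ ∃ γ' : Path V (n+1), Allowed G γ' ∧ IsFace (face i γ) γ' ∧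
      fPath f γ' = fPath f (face i γ) := ⟨hα, γ, hγ, ⟨i, rfl⟩, hval⟩
  have hc := h.2.choose_spec
  have heq : h.2.choose = γ :=
    hf.2.1 n _ hα _ _ hc.1 hγ hc.2.1 ⟨i, rfl⟩ hc.2.2 hval
  rw [grad_unitP, gradFun, dif_pos h, heq, boundary_unitP_apply_face (hγ.injective hG)]

theorem HasEqualCoface.exists_face {V : Type} {G : Digraph V} {f : V → ℝ} {n : ℕ} {p : Path V n}
    (h : HasEqualCoface G f p) :
    ∃ (γ : Path V (n+1)) (i : Fin (n+2)), Allowed G γ ∧ face i γ = p ∧ f (γ i) = 0 := by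
  obtain ⟨γ, hγ, ⟨i, rfl⟩, hval⟩ := h
  refine ⟨γ, i, hγ, rfl, ?_⟩
  rwa [fPath_face f γ i, add_eq_right] at hval

theorem grad_grad {G : Digraph V} {f : V → ℝ} (hG : G.Transitive) (hf : IsMorse G f)
    (n : ℕ) (x : Chain V n) : grad G f (n+1) (grad G f n x) = 0 := by
  suffices h : (grad G f (n+1)).comp (grad G f n) = 0 from LinearMap.congr_fun h x
  refine linearMap_ext_unitP fun p => ?_
  rw [LinearMap.comp_apply, LinearMap.zero_apply]
  by_cases hp : HasEqualCoface G f p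
  · obtain ⟨γ, i, hγ, rfl, hi⟩ := hp.exists_face
    rw [grad_unitP_face hG hf hγ hi, map_smul,
      grad_unitP_eq_zero (not_hasEqualCoface_of_apply_eq_zero hG hf hi), smul_zero]
  · rw [grad_unitP_eq_zero hp, map_zero]

theorem grad_boundary_grad {G : Digraph V} {f : V → ℝ} (hG : G.Transitive) (hf : IsMorse G f)
    (n : ℕ) (x : Chain V n) : grad G f n (boundary V n (grad G f n x)) = -grad G f n x := by
  suffices h : (grad G f n).comp ((boundary V n).comp (grad G f n)) = -grad G f n from
    LinearMap.congr_fun h x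
  refine linearMap_ext_unitP fun p => ?_
  rw [LinearMap.comp_apply, LinearMap.comp_apply, LinearMap.neg_apply]
  by_cases hp : HasEqualCoface G f p
  · obtain ⟨γ, i, hγ, rfl, hi⟩ := hp.exists_face
    have hother : ∀ j, j ≠ i → grad G f n (unitP (face j γ)) = 0 := by
      intro j hj
      obtain ⟨k, hk⟩ := Fin.exists_succAbove_eq hj.symm
      refine grad_unitP_eq_zero (not_hasEqualCoface_of_apply_eq_zero hG hf (i := k) ?_)
      simpa only [face, Function.comp_apply, hk] using hi
    have hsum : grad G f n (boundary V n (unitP γ)) = - unitP γ := by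
      rw [boundary_unitP, map_sum, Finset.sum_eq_single i]
      · rw [map_smul, grad_unitP_face hG hf hγ hi, smul_smul, mul_neg, ← pow_add, ← two_mul,
          pow_mul, neg_one_sq, one_pow, neg_one_smul]
      · intro j _ hj
        rw [map_smul, hother j hj, smul_zero]
      · simp
    rw [grad_unitP_face hG hf hγ hi, map_smul, map_smul, hsum, smul_neg]
  · rw [grad_unitP_eq_zero hp, map_zero, map_zero, neg_zero]

theorem grad_apply_eq_zero {G : Digraph V} {f : V → ℝ} {n : ℕ} (x : Chain V n)
    {p : Path V (n+1)} (hp : ¬ HasEqualFace G f (n+1) p) : grad G f n x p = 0 := by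
  suffices h : (LinearMap.proj p).comp (grad G f n) = (0 : Chain V n →ₗ[ℝ] ℝ) from
    LinearMap.congr_fun h x
  refine linearMap_ext_unitP fun q => ?_
  rw [LinearMap.comp_apply, grad_unitP, gradFun]
  split_ifs with h
  · have hne : p ≠ h.2.choose := fun heq =>
      hp ⟨q, h.1, heq ▸ h.2.choose_spec.2.1, heq ▸ h.2.choose_spec.2.2.symm⟩
    simp [unitP, hne]
  · simp

theorem apply_face_eq_zero_of_grad_eq_zero {G : Digraph V} {f : V → ℝ} (hG : G.Transitive)
    (hf : IsMorse G f) {n : ℕ} {x : Chain V n} (hx : grad G f n x = 0) {p : Path V n}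
    (hp : HasEqualCoface G f p) : x p = 0 := by
  obtain ⟨γ, i, hγ, rfl, hi⟩ := hp.exists_face
  have hval : fPath f γ = fPath f (face i γ) := by rw [fPath_face f γ i, hi, zero_add]
  have hcoeff : grad G f n x γ = x (face i γ) * -(-1) ^ (i : ℕ) := by
    rw [← sum_smul_unitP x, map_sum, Finset.sum_apply, Finset.sum_eq_single (face i γ),
      sum_smul_unitP, map_smul, grad_unitP_face hG hf hγ hi]
    · simp [unitP]
    · intro q _ hq
      rw [map_smul, grad_unitP, gradFun]
      split_ifs with h
      · have hne : γ ≠ h.2.choose := by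
          intro heq
          have hs := h.2.choose_spec
          rw [← heq] at hs
          exact hq (hf.2.2 n γ hγ _ _ h.1 (hγ.face hG i) hs.2.1 ⟨i, rfl⟩ hs.2.2.symm hval.symm)
        simp [unitP, hne]
      · simp
    · simp
  rw [hx] at hcoeff
  simpa using hcoeff.symm

theorem flow_apply_zero (G : Digraph V) (f : V → ℝ) (x : Chain V 0) :
    flow G f 0 x = x + boundary V 0 (grad G f 0 x) := by
  simp [flow, vd]

theorem flow_apply_succ (G : Digraph V) (f : V → ℝ) (n : ℕ) (x : Chain V (n+1)) :
    flow G f (n+1) x =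
      x + boundary V (n+1) (grad G f (n+1) x) + grad G f n (boundary V n x) := by
  simp [flow, vd]

theorem boundary_flow (G : Digraph V) (f : V → ℝ) (n : ℕ) (x : Chain V (n+1)) :
    boundary V n (flow G f (n+1) x) = flow G f n (boundary V n x) := by
  cases n with
  | zero => simp [flow_apply_zero, flow_apply_succ, boundary_boundary]
  | succ n => simp [flow_apply_succ, boundary_boundary]

theorem flow_grad {G : Digraph V} {f : V → ℝ} (hG : G.Transitive) (hf : IsMorse G f)
    (n : ℕ) (x : Chain V n) : flow G f (n+1) (grad G f n x) = 0 := by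
  simp [flow_apply_succ, grad_grad hG hf, grad_boundary_grad hG hf]

theorem grad_flow {G : Digraph V} {f : V → ℝ} (hG : G.Transitive) (hf : IsMorse G f)
    (n : ℕ) (x : Chain V n) : grad G f n (flow G f n x) = 0 := by
  cases n with
  | zero => simp [flow_apply_zero, grad_boundary_grad hG hf]
  | succ n => simp [flow_apply_succ, grad_grad hG hf, grad_boundary_grad hG hf]

theorem flow_flow {G : Digraph V} {f : V → ℝ} (hG : G.Transitive) (hf : IsMorse G f)
    (n : ℕ) (x : Chain V n) : flow G f n (flow G f n x) = flow G f n x := by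
  cases n with
  | zero => rw [flow_apply_zero _ _ (flow G f 0 x), grad_flow hG hf, map_zero, add_zero]
  | succ n =>
    rw [flow_apply_succ _ _ _ (flow G f (n+1) x), grad_flow hG hf, map_zero, add_zero,
      boundary_flow, grad_flow hG hf, add_zero]

theorem flow_mem_omega {G Gbar : Digraph V} {f : V → ℝ}
    (hinv : ∀ n, ∀ x ∈ omega G n, grad Gbar f n x ∈ omega G (n+1)) {n : ℕ} {x : Chain V n}
    (hx : x ∈ omega G n) : flow Gbar f n x ∈ omega G n := by
  have hbg := add_mem hx (boundary_mem_omega (hinv n x hx))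
  cases n with
  | zero => rwa [flow_apply_zero]
  | succ n =>
    rw [flow_apply_succ]
    exact add_mem hbg (hinv n _ (boundary_mem_omega hx))

theorem flow_unitP_eq_zero {G : Digraph V} {f : V → ℝ} (hG : G.Transitive) (hf : IsMorse G f)
    {n : ℕ} {p : Path V n} (hp : Allowed G p) (h : HasEqualFace G f n p) :
    flow G f n (unitP p) = 0 := by
  cases n with
  | zero => exact h.elim
  | succ n =>
    obtain ⟨_, -, ⟨i, rfl⟩, hval⟩ := h
    have hi : f (p i) = 0 := by rwa [fPath_face f p i, right_eq_add] at hval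
    have h1 := flow_grad hG hf n (unitP (face i p))
    rw [grad_unitP_face hG hf hp hi, map_smul] at h1
    exact (smul_eq_zero.1 h1).resolve_left (by simp)

/-- A flow-invariant chain of allowed paths is determined by its coefficients on critical paths. -/
theorem eq_zero_of_flow_eq_self {G : Digraph V} {f : V → ℝ} (hG : G.Transitive)
    (hf : IsMorse G f) {n : ℕ} {x : Chain V n} (hx : flow G f n x = x)
    (hallowed : ∀ p, ¬ Allowed G p → x p = 0) (hcrit : ∀ p, IsCritical G f p → x p = 0) :
    x = 0 := by
  rw [← hx]
  conv_lhs => rw [← sum_smul_unitP x]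
  rw [map_sum]
  refine Finset.sum_eq_zero fun p _ => ?_
  rw [map_smul]
  by_cases hp : Allowed G p
  · by_cases hface : HasEqualFace G f n p
    · rw [flow_unitP_eq_zero hG hf hp hface, smul_zero]
    · suffices h : x p = 0 by rw [h, zero_smul]
      by_cases hco : HasEqualCoface G f p
      · exact apply_face_eq_zero_of_grad_eq_zero hG hf (hx ▸ grad_flow hG hf n x) hco
      · exact hcrit p ⟨hp, hco, hface⟩
  · rw [hallowed p hp, zero_smul]

theorem flow_unitP_apply_of_isCritical {G : Digraph V} {f : V → ℝ} {n : ℕ} {p q : Path V n}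
    (hp : IsCritical G f p) (hq : IsCritical G f q) :
    flow G f n (unitP p) q = unitP p q := by
  cases n with
  | zero => rw [flow_apply_zero, grad_unitP_eq_zero hp.2.1, map_zero, add_zero]
  | succ n =>
    rw [flow_apply_succ, grad_unitP_eq_zero hp.2.1, map_zero, add_zero, Pi.add_apply,
      grad_apply_eq_zero _ hq.2.2, add_zero]

theorem finrank_map_add_finrank_inf_ker {M N : Type*} [AddCommGroup M] [Module ℝ M]
    [FiniteDimensional ℝ M] [AddCommGroup N] [Module ℝ N] (S : Submodule ℝ M) (g : M →ₗ[ℝ] N) :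
    Module.finrank ℝ (S.map g) + Module.finrank ℝ (S ⊓ LinearMap.ker g : Submodule ℝ M) =
      Module.finrank ℝ S := by
  have h := (g.domRestrict S).finrank_range_add_finrank_ker
  rw [LinearMap.range_domRestrict, LinearMap.ker_domRestrict] at h
  rw [← h, (Submodule.equivSubtypeMap S _).finrank_eq, Submodule.map_comap_subtype]

theorem finrank_homology_add (G : Digraph V) (n : ℕ) :
    Module.finrank ℝ (Homology (omega G) (fun n => boundary V n) n) +
      Module.finrank ℝ ((omega G (n+1)).map (boundary V n)) =
      Module.finrank ℝ (cycles (omega G) (fun n => boundary V n) n) := by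
  have hle : (omega G (n+1)).map (boundary V n) ≤ cycles (omega G) (fun n => boundary V n) n := by
    rintro _ ⟨x, hx, rfl⟩
    have hmem := boundary_mem_omega hx
    cases n with
    | zero => exact hmem
    | succ n => exact ⟨hmem, boundary_boundary n x⟩
  rw [← (Submodule.comapSubtypeEquivOfLe hle).finrank_eq]
  exact Submodule.finrank_quotient_add_finrank _

theorem finrank_omega_zero_eq (G : Digraph V) :
    Module.finrank ℝ (omega G 0) =
      Module.finrank ℝ (Homology (omega G) (fun n => boundary V n) 0) +
      Module.finrank ℝ ((omega G (0+1)).map (boundary V 0)) :=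
  (finrank_homology_add G 0).symm

theorem finrank_omega_eq (G : Digraph V) (n : ℕ) :
    Module.finrank ℝ (omega G (n+1)) =
      Module.finrank ℝ (Homology (omega G) (fun n => boundary V n) (n+1)) +
      Module.finrank ℝ ((omega G (n+1+1)).map (boundary V (n+1))) +
      Module.finrank ℝ ((omega G (n+1)).map (boundary V n)) := by
  rw [finrank_homology_add, ← finrank_map_add_finrank_inf_ker _ (boundary V n), add_comm]
  rfl

theorem finrank_ker_flow_zero_eq {G Gbar : Digraph V} {f : V → ℝ} (hG : Gbar.Transitive)
    (hf : IsMorse Gbar f) (hinv : ∀ n, ∀ x ∈ omega G n, grad Gbar f n x ∈ omega G (n+1)) :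
    Module.finrank ℝ (omega G 0 ⊓ LinearMap.ker (flow Gbar f 0) : Submodule ℝ (Chain V 0)) =
      Module.finrank ℝ ((omega G (0+1) ⊓ LinearMap.ker (flow Gbar f (0+1))).map (boundary V 0)) := by
  suffices h : omega G 0 ⊓ LinearMap.ker (flow Gbar f 0) =
      (omega G (0+1) ⊓ LinearMap.ker (flow Gbar f (0+1))).map (boundary V 0) by rw [h]
  apply le_antisymm
  · rintro x ⟨hx, hxk⟩
    refine ⟨-grad Gbar f 0 x, neg_mem ⟨hinv 0 x hx, flow_grad hG hf 0 x⟩, ?_⟩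
    rw [SetLike.mem_coe, LinearMap.mem_ker, flow_apply_zero] at hxk
    rw [map_neg, ← eq_neg_of_add_eq_zero_left hxk]
  · rintro _ ⟨x, ⟨hx, hxk⟩, rfl⟩
    refine ⟨boundary_mem_omega hx, ?_⟩
    rw [SetLike.mem_coe, LinearMap.mem_ker, ← boundary_flow, LinearMap.mem_ker.1 hxk, map_zero]

theorem finrank_ker_flow_eq {G Gbar : Digraph V} {f : V → ℝ} (hG : Gbar.Transitive)
    (hf : IsMorse Gbar f) (hinv : ∀ n, ∀ x ∈ omega G n, grad Gbar f n x ∈ omega G (n+1)) (n : ℕ) :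
    Module.finrank ℝ
        (omega G (n+1) ⊓ LinearMap.ker (flow Gbar f (n+1)) : Submodule ℝ (Chain V (n+1))) =
      Module.finrank ℝ
        ((omega G (n+1+1) ⊓ LinearMap.ker (flow Gbar f (n+1+1))).map (boundary V (n+1))) +
      Module.finrank ℝ
        ((omega G (n+1) ⊓ LinearMap.ker (flow Gbar f (n+1))).map (boundary V n)) := by
  rw [← finrank_map_add_finrank_inf_ker _ (boundary V n), add_comm]
  suffices h : omega G (n+1) ⊓ LinearMap.ker (flow Gbar f (n+1)) ⊓ LinearMap.ker (boundary V n) =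
      (omega G (n+1+1) ⊓ LinearMap.ker (flow Gbar f (n+1+1))).map (boundary V (n+1)) by rw [h]
  apply le_antisymm
  · rintro x ⟨⟨hx, hxk⟩, hx0⟩
    refine ⟨-grad Gbar f (n+1) x, neg_mem ⟨hinv _ x hx, flow_grad hG hf _ x⟩, ?_⟩
    rw [SetLike.mem_coe, LinearMap.mem_ker] at hxk hx0
    rw [flow_apply_succ, hx0, map_zero, add_zero] at hxk
    rw [map_neg, ← eq_neg_of_add_eq_zero_left hxk]
  · rintro _ ⟨x, ⟨hx, hxk⟩, rfl⟩
    refine ⟨⟨boundary_mem_omega hx, ?_⟩, boundary_boundary n x⟩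
    rw [SetLike.mem_coe, LinearMap.mem_ker, ← boundary_flow, LinearMap.mem_ker.1 hxk, map_zero]

theorem finrank_map_flow_omega {G Gbar : Digraph V} {f : V → ℝ} (hG : Gbar.Transitive)
    (hf : IsMorse Gbar f) (hsub : ∀ u v, G.E u v → Gbar.E u v)
    (hinv : ∀ n, ∀ x ∈ omega G n, grad Gbar f n x ∈ omega G (n+1)) {n : ℕ}
    (hflow : ∀ α : Path V n, Allowed G α → IsCritical Gbar f α →
      flow Gbar f n (unitP α) ∈ omega G n) :
    Module.finrank ℝ ((omega G n).map (flow Gbar f n)) =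
      Nat.card {p : Path V n // IsCritical Gbar f p ∧ Allowed G p} := by
  let S := {p : Path V n // IsCritical Gbar f p ∧ Allowed G p}
  let R : ((omega G n).map (flow Gbar f n)) →ₗ[ℝ] (S → ℝ) :=
    (LinearMap.funLeft ℝ ℝ (Subtype.val : S → Path V n)).comp (Submodule.subtype _)
  have hinj : Function.Injective R := by
    rw [← LinearMap.ker_eq_bot, LinearMap.ker_eq_bot']
    rintro ⟨_, y, hy, rfl⟩ hR
    have hmem := omega_le_pSpan G n (flow_mem_omega hinv hy)
    refine Subtype.ext (eq_zero_of_flow_eq_self hG hf (flow_flow hG hf n y) (fun p hp => ?_)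
      fun p hp => ?_)
    · exact eq_zero_of_mem_pSpan hmem fun h => hp fun i => hsub _ _ (h i)
    · by_cases h : Allowed G p
      · exact congrFun hR ⟨p, hp, h⟩
      · exact eq_zero_of_mem_pSpan hmem h
  have hsurj : Function.Surjective R := by
    rw [← LinearMap.range_eq_top, eq_top_iff, ← (Pi.basisFun ℝ S).span_eq, Submodule.span_le]
    rintro _ ⟨α, rfl⟩
    refine ⟨⟨flow Gbar f n (unitP α.1), _, hflow α.1 α.2.2 α.2.1, flow_flow hG hf n _⟩, ?_⟩
    funext β
    change flow Gbar f n (unitP α.1) β.1 = _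
    rw [flow_unitP_apply_of_isCritical α.2.1 β.2.1]
    simp only [unitP, Pi.single_apply, Pi.basisFun_apply]
    exact if_congr Subtype.ext_iff.symm rfl rfl
  rw [(LinearEquiv.ofBijective R ⟨hinj, hsurj⟩).finrank_eq, Module.finrank_fintype_fun_eq_card,
    Nat.card_eq_fintype_card]

theorem finrank_omega_eq_card_add {G Gbar : Digraph V} {f : V → ℝ} (hG : Gbar.Transitive)
    (hf : IsMorse Gbar f) (hsub : ∀ u v, G.E u v → Gbar.E u v)
    (hinv : ∀ n, ∀ x ∈ omega G n, grad Gbar f n x ∈ omega G (n+1)) {n : ℕ}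
    (hflow : ∀ α : Path V n, Allowed G α → IsCritical Gbar f α →
      flow Gbar f n (unitP α) ∈ omega G n) :
    Module.finrank ℝ (omega G n) =
      Nat.card {p : Path V n // IsCritical Gbar f p ∧ Allowed G p} +
      Module.finrank ℝ (omega G n ⊓ LinearMap.ker (flow Gbar f n) : Submodule ℝ (Chain V n)) := by
  rw [← finrank_map_flow_omega hG hf hsub hinv hflow, finrank_map_add_finrank_inf_ker]

theorem alternating_sum_succ (a : ℕ → ℤ) (m : ℕ) :
    ∑ i ∈ Finset.range (m+2), (-1 : ℤ)^(m+1-i) * a i =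
      a (m+1) - ∑ i ∈ Finset.range (m+1), (-1 : ℤ)^(m-i) * a i := by
  rw [Finset.sum_range_succ, Nat.sub_self, pow_zero, one_mul, add_comm, sub_eq_add_neg,
    ← Finset.sum_neg_distrib]
  congr 1
  refine Finset.sum_congr rfl fun i hi => ?_
  rw [Nat.sub_add_comm (Nat.lt_succ_iff.1 (Finset.mem_range.1 hi)), pow_succ]
  ring

/-- Strong Morse inequalities on digraphs and equality of Euler characteristics,
with `l_m` the number of `m`-paths critical in `Ḡ` and allowed in `G` and `b_m` the Betti numbers
of path homology. -/
theorem stmt19 {V : Type} [Fintype V] [DecidableEq V] (G Gbar : Digraph V)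
    (hcl : IsTransClosure G Gbar) (f : V → ℝ) (hf : IsMorse Gbar f)
    (hinv : ∀ n, ∀ x ∈ omega G n, grad Gbar f n x ∈ omega G (n+1))
    (hflow : ∀ (n : ℕ) (α : Path V n), Allowed G α → IsCritical Gbar f α →
      flow Gbar f n (unitP α) ∈ omega G n) :
    (∀ m : ℕ,
      (∑ i ∈ Finset.range (m+1), (-1 : ℤ)^(m-i) *
        (Nat.card {p : Path V i // IsCritical Gbar f p ∧ Allowed G p} : ℤ)) ≥
      (∑ i ∈ Finset.range (m+1), (-1 : ℤ)^(m-i) *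
        (Module.finrank ℝ (Homology (omega G) (fun n => boundary V n) i) : ℤ))) ∧
    (∀ N : ℕ,
      (∀ p, N < p → Nat.card {q : Path V p // IsCritical Gbar f q ∧ Allowed G q} = 0) →
      (∀ p, N < p → Module.finrank ℝ (Homology (omega G) (fun n => boundary V n) p) = 0) →
      (∑ p ∈ Finset.range (N+1), (-1 : ℤ)^p *
        (Nat.card {q : Path V p // IsCritical Gbar f q ∧ Allowed G q} : ℤ)) =
      (∑ p ∈ Finset.range (N+1), (-1 : ℤ)^p *
        (Module.finrank ℝ (Homology (omega G) (fun n => boundary V n) p) : ℤ))) := by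
  have hG := hcl.1
  have hsub := hcl.2.1
  have hbetti := finrank_omega_eq G
  have hker := finrank_ker_flow_eq hG hf hinv
  have hsplit := fun n => finrank_omega_eq_card_add hG hf hsub hinv (hflow n)
  have hsum : ∀ m : ℕ,
      (∑ i ∈ Finset.range (m+1), (-1 : ℤ)^(m-i) *
        (Nat.card {p : Path V i // IsCritical Gbar f p ∧ Allowed G p} : ℤ)) -
      (∑ i ∈ Finset.range (m+1), (-1 : ℤ)^(m-i) *
        (Module.finrank ℝ (Homology (omega G) (fun n => boundary V n) i) : ℤ)) =
      (Module.finrank ℝ ((omega G (m+1)).map (boundary V m)) : ℤ) -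
      Module.finrank ℝ ((omega G (m+1) ⊓ LinearMap.ker (flow Gbar f (m+1))).map (boundary V m)) := by
    intro m
    induction m with
    | zero =>
      have h1 := finrank_omega_zero_eq G
      have h2 := finrank_ker_flow_zero_eq hG hf hinv
      have h3 := hsplit 0
      simp only [Finset.sum_range_succ, Finset.sum_range_zero, zero_add, Nat.sub_self, pow_zero, one_mul] at h1 h2 h3 ⊢
      omega
    | succ m ih =>
      have h1 := hbetti m
      have h2 := hker m
      have h3 := hsplit (m+1)
      rw [alternating_sum_succ, alternating_sum_succ
        (fun i => (Module.finrank ℝ (Homology (omega G) (fun n => boundary V n) i) : ℤ))]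
      omega
  refine ⟨fun m => ?_, fun N hl _ => ?_⟩
  · have h1 := hsum m
    have h2 := Submodule.finrank_mono (Submodule.map_mono (f := boundary V m)
      (inf_le_left : omega G (m+1) ⊓ LinearMap.ker (flow Gbar f (m+1)) ≤ omega G (m+1)))
    omega
  · have h1 := hsum N
    have h2 : omega G (N+1) ⊓ LinearMap.ker (flow Gbar f (N+1)) = omega G (N+1) := by
      refine Submodule.eq_of_le_of_finrank_eq inf_le_left ?_
      rw [hsplit (N+1), hl (N+1) N.lt_succ_self, zero_add]
    rw [h2, sub_self, sub_eq_zero] at h1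
    have h3 : ∀ a : ℕ → ℤ, ∑ p ∈ Finset.range (N+1), (-1 : ℤ)^p * a p =
        (-1)^N * ∑ p ∈ Finset.range (N+1), (-1 : ℤ)^(N-p) * a p := by
      intro a
      rw [Finset.mul_sum]
      refine Finset.sum_congr rfl fun p hp => ?_
      have hp' : p ≤ N := Nat.lt_succ_iff.1 (Finset.mem_range.1 hp)
      obtain ⟨k, rfl⟩ := Nat.exists_eq_add_of_le hp'
      rw [Nat.add_sub_cancel_left, ← mul_assoc, ← pow_add, add_assoc, ← two_mul, pow_add, pow_mul]
      simp
    rw [h3, h1, ← h3]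

end PathMorse
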